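/- Let m > 0 and let G₁, G₂ ⊆ ℝ³ be disjoint nonempty open sets. Then there exist smooth compactly supported real-valued functions u, v on ℝ³ with supp(u) ⊆ G₁ and supp(v) ⊆ G₂ such that ⟪u, H⁻¹ v⟫ ≠ 0. -/

import Mathlib

open MeasureTheory Complex FourierTransform

noncomputable section

/-- Physical space `ℝ³`. -/
abbrev E3 : Type := EuclideanSpace ℝ (Fin 3)

/-- The relativistic dispersion symbol `ω_m(ξ) = √(‖ξ‖² + m²)`. -/
def omegam (m : ℝ) (ξ : E3) : ℝ := Real.sqrt (‖ξ‖ ^ 2 + m ^ 2)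

/-- The operator `H^s = (−∇² + m²)^{s/2}`, acting as the Fourier multiplier with symbol
`ω_m^s`: `H^s u = 𝓕⁻¹(ω_m^s · 𝓕u)`. -/
def Hpow (m s : ℝ) (u : E3 → ℂ) : E3 → ℂ :=
  𝓕⁻ (fun ξ => ((omegam m ξ ^ s : ℝ) : ℂ) * 𝓕 u ξ)

lemma omegam_pos {m : ℝ} (hm : 0 < m) (ξ : E3) : 0 < omegam m ξ :=
  Real.sqrt_pos.2 (by positivity)

lemma continuous_omegam (m : ℝ) : Continuous (omegam m) := by
  unfold omegam
  fun_prop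

lemma omegam_rpow_neg_one_le {m : ℝ} (hm : 0 < m) (ξ : E3) : omegam m ξ ^ (-1 : ℝ) ≤ m⁻¹ := by
  rw [Real.rpow_neg_one]
  refine inv_anti₀ hm (Real.le_sqrt_of_sq_le ?_)
  nlinarith [sq_nonneg ‖ξ‖]

lemma integral_rpow_neg_half_mul_exp {r : ℝ} (hr : 0 < r) :
    ∫ t in Set.Ioi (0 : ℝ), t ^ (-(1 / 2) : ℝ) * Real.exp (-(r * t)) =
      √Real.pi * (√r)⁻¹ := by
  have h := Real.integral_rpow_mul_exp_neg_mul_Ioi (a := 1 / 2) (by norm_num) hr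
  rw [Real.Gamma_one_half_eq, ← Real.sqrt_eq_rpow, one_div r, Real.sqrt_inv] at h
  norm_num at h ⊢
  rw [h, mul_comm]

lemma integrableOn_rpow_neg_half_mul_exp {r : ℝ} (hr : 0 < r) :
    IntegrableOn (fun t : ℝ => t ^ (-(1 / 2) : ℝ) * Real.exp (-(r * t))) (Set.Ioi 0) := by
  refine Integrable.of_integral_ne_zero ?_
  rw [integral_rpow_neg_half_mul_exp hr]
  have := Real.pi_pos
  positivity

/-- Subordination of `ω_m⁻¹` to the Gaussians. -/
lemma omegam_rpow_neg_one {m : ℝ} (hm : 0 < m) (ξ : E3) :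
    omegam m ξ ^ (-1 : ℝ) = (√Real.pi)⁻¹ *
      ∫ t in Set.Ioi (0 : ℝ), t ^ (-(1 / 2) : ℝ) * Real.exp (-((‖ξ‖ ^ 2 + m ^ 2) * t)) := by
  rw [integral_rpow_neg_half_mul_exp (by positivity), Real.rpow_neg_one, omegam,
    inv_mul_cancel_left₀ (by have := Real.pi_pos; positivity)]

/-- The Fourier multiplier `exp (-t ‖ξ‖²)` acts by convolution with a Gaussian. -/
lemma fourierInv_exp_mul_fourier {v : E3 → ℝ} (hv : Integrable v) {t : ℝ} (ht : 0 < t) (x : E3) :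
    𝓕⁻ (fun ξ : E3 => (Real.exp (-(t * ‖ξ‖ ^ 2)) : ℂ) * 𝓕 (fun y => (v y : ℂ)) ξ) x =
      (((Real.pi / t) ^ (3 / 2 : ℝ) *
        ∫ y, v y * Real.exp (-(Real.pi ^ 2 * ‖x - y‖ ^ 2 / t)) : ℝ) : ℂ) := by
  set g : E3 → ℂ := fun ξ =>
    cexp (-(t : ℂ) * ‖ξ‖ ^ 2 + 2 * Real.pi * Complex.I * inner ℝ x ξ) with hg
  have hgi : Integrable g :=
    GaussianFourier.integrable_cexp_neg_mul_sq_norm_add (by simpa using ht) _ _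
  have hflip : ∫ ξ, 𝓕 (fun y => (v y : ℂ)) ξ * g ξ = ∫ y, (v y : ℂ) * 𝓕 g y := by
    simpa using! VectorFourier.integral_fourierIntegral_smul_eq_flip (L := innerₗ E3)
      Real.continuous_fourierChar continuous_inner hv.ofReal hgi
  rw [Real.fourierInv_eq', ofReal_mul, ← integral_complex_ofReal, ← integral_const_mul]
  trans ∫ ξ, 𝓕 (fun y => (v y : ℂ)) ξ * g ξ
  · congr 1 with ξ
    simp only [hg, smul_eq_mul, real_inner_comm x ξ, Complex.exp_add]
    push_cast
    ring_nf
  rw [hflip]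
  congr 1 with y
  rw [hg, fourier_gaussian_innerProductSpace' (by simpa using ht),
    ofReal_cpow (by have := Real.pi_pos; positivity)]
  simp only [finrank_euclideanSpace, Fintype.card_fin]
  push_cast
  ring_nf

lemma integrable_fourier_of_contDiff {v : E3 → ℝ} (hv : ContDiff ℝ (⊤ : ℕ∞) v)
    (hvc : HasCompactSupport v) : Integrable (𝓕 (fun y => (v y : ℂ))) := by
  have hc : HasCompactSupport (fun y => (v y : ℂ)) := hvc.comp_left ofReal_zero
  exact (𝓕 (hc.toSchwartzMap (Complex.ofRealCLM.contDiff.comp hv))).integrable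

lemma integrable_omegam_mul {m : ℝ} (hm : 0 < m) {f : E3 → ℂ} (hf : Integrable f) :
    Integrable (fun ξ => ((omegam m ξ ^ (-1 : ℝ) : ℝ) : ℂ) * f ξ) := by
  refine hf.bdd_mul (c := m⁻¹) ?_ (.of_forall fun ξ => ?_)
  · exact (continuous_ofReal.comp ((continuous_omegam m).rpow_const
      fun ξ => .inl (omegam_pos hm ξ).ne')).aestronglyMeasurable
  · rw [norm_real, Real.norm_of_nonneg (Real.rpow_nonneg (omegam_pos hm ξ).le _)]
    exact omegam_rpow_neg_one_le hm ξ

lemma continuous_Hpow_neg_one {m : ℝ} (hm : 0 < m) {u : E3 → ℂ} (hu : Integrable (𝓕 u)) :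
    Continuous (Hpow m (-1) u) :=
  VectorFourier.fourierIntegral_continuous Real.continuous_fourierChar
    (by exact continuous_inner.neg) (integrable_omegam_mul hm hu)

/-- `H⁻¹` is positivity improving. -/
lemma exists_pos_Hpow_neg_one_eq {m : ℝ} (hm : 0 < m) {v : E3 → ℝ}
    (hv : ContDiff ℝ (⊤ : ℕ∞) v) (hvc : HasCompactSupport v) (hv0 : 0 ≤ v) {y₀ : E3}
    (hy₀ : v y₀ ≠ 0) (x : E3) :
    ∃ r : ℝ, 0 < r ∧ Hpow m (-1) (fun y => (v y : ℂ)) x = r := by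
  have hpi := Real.pi_pos
  set w : E3 → ℂ := 𝓕 (fun y => (v y : ℂ)) with hw
  have hwi : Integrable w := integrable_fourier_of_contDiff hv hvc
  set e : E3 → ℂ := fun ξ => cexp ((2 * Real.pi * inner ℝ ξ x : ℝ) * Complex.I) with he
  have hec : Continuous e := by fun_prop
  set k : E3 → ℝ → ℝ := fun ξ t =>
    t ^ (-(1 / 2) : ℝ) * Real.exp (-((‖ξ‖ ^ 2 + m ^ 2) * t)) with hk
  set f : E3 → ℝ → ℂ := fun ξ t => e ξ * w ξ * k ξ t with hf
  have hfi : Integrable (Function.uncurry f) (volume.prod (volume.restrict (Set.Ioi 0))) := by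
    have hprod := hwi.norm.mul_prod
      (integrableOn_rpow_neg_half_mul_exp (r := m ^ 2) (by positivity))
    refine hprod.mono' ?_ ?_
    · refine .mul (.mul ?_ ?_) ?_
      · exact (hec.comp continuous_fst).aestronglyMeasurable
      · exact hwi.aestronglyMeasurable.comp_fst
      · have : Measurable (Function.uncurry k) := by
          simp only [hk, Function.uncurry_def]
          fun_prop
        exact (measurable_ofReal.comp this).aestronglyMeasurable
    · have hmem : ∀ᵐ p : E3 × ℝ ∂(volume.prod (volume.restrict (Set.Ioi 0))), 0 < p.2 :=
        Measure.quasiMeasurePreserving_snd.ae (ae_restrict_mem measurableSet_Ioi)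
      filter_upwards [hmem] with p hp
      have h1 : ‖e p.1‖ = 1 := norm_exp_ofReal_mul_I _
      have h2 : 0 ≤ k p.1 p.2 := by simp only [hk]; positivity
      simp only [Function.uncurry, hf, norm_mul, h1, one_mul, norm_real, Real.norm_of_nonneg h2]
      simp only [hk]
      gcongr
      nlinarith [sq_nonneg ‖p.1‖]
  set J : ℝ → ℝ := fun t => ∫ y, v y * Real.exp (-(Real.pi ^ 2 * ‖x - y‖ ^ 2 / t)) with hJ
  set g : ℝ → ℝ := fun t =>
    t ^ (-(1 / 2) : ℝ) * Real.exp (-(m ^ 2 * t)) * ((Real.pi / t) ^ (3 / 2 : ℝ) * J t) with hg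
  have hJpos : ∀ t, 0 < J t := fun t => by
    refine Continuous.integral_pos_of_hasCompactSupport_nonneg_nonzero (x := y₀) ?_
      hvc.mul_right (fun y => mul_nonneg (hv0 y) (Real.exp_nonneg _))
      (mul_ne_zero hy₀ (Real.exp_ne_zero _))
    have := hv.continuous
    fun_prop
  have hgpos : ∀ t ∈ Set.Ioi (0 : ℝ), 0 < g t := fun t (ht : 0 < t) => by
    have := hJpos t
    simp only [hg]
    positivity
  have hfg : ∀ t ∈ Set.Ioi (0 : ℝ), ∫ ξ, f ξ t = g t := fun t ht => by
    have h := fourierInv_exp_mul_fourier (hv.continuous.integrable_of_hasCompactSupport hvc) ht x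
    rw [Real.fourierInv_eq'] at h
    rw [hg, ofReal_mul, ← h, ← integral_const_mul]
    congr 1 with ξ
    have hexp : Real.exp (-((‖ξ‖ ^ 2 + m ^ 2) * t)) =
        Real.exp (-(m ^ 2 * t)) * Real.exp (-(t * ‖ξ‖ ^ 2)) := by
      rw [← Real.exp_add]
      ring_nf
    simp only [hf, hk, he, hw, hexp, smul_eq_mul, ofReal_mul]
    ring
  have hgi : IntegrableOn g (Set.Ioi 0) := by
    have h := (hfi.integral_prod_right.congr
      ((ae_restrict_iff' measurableSet_Ioi).2 (.of_forall hfg))).re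
    simpa [IntegrableOn] using h
  refine ⟨(√Real.pi)⁻¹ * ∫ t in Set.Ioi 0, g t, mul_pos (by positivity) ?_, ?_⟩
  · rw [setIntegral_pos_iff_support_of_nonneg_ae
      ((ae_restrict_iff' measurableSet_Ioi).2 (.of_forall fun t ht => (hgpos t ht).le)) hgi,
      Set.inter_eq_right.2 fun t ht => Function.mem_support.2 (hgpos t ht).ne']
    simp
  · rw [ofReal_mul, ← integral_complex_ofReal, ← setIntegral_congr_fun measurableSet_Ioi hfg,
      ← integral_integral_swap hfi, ← integral_const_mul, Hpow, Real.fourierInv_eq']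
    congr 1 with ξ
    simp only [hf]
    rw [integral_const_mul, integral_complex_ofReal, omegam_rpow_neg_one hm]
    simp only [he, hk, hw, smul_eq_mul, ofReal_mul]
    ring

/-- A nonempty open set supports a nonnegative nonzero test function. -/
lemma exists_contDiff_nonneg_tsupport_subset {G : Set E3} (hG : IsOpen G) (hne : G.Nonempty) :
    ∃ u : E3 → ℝ, ContDiff ℝ (⊤ : ℕ∞) u ∧ HasCompactSupport u ∧ tsupport u ⊆ G ∧ 0 ≤ u ∧
      ∃ x, u x ≠ 0 := by
  obtain ⟨x, hx⟩ := hne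
  obtain ⟨u, hsupp, hcomp, hu, hrange, hux⟩ :=
    exists_contDiff_tsupport_subset (n := (⊤ : ℕ∞)) (hG.mem_nhds hx)
  exact ⟨u, hu, hcomp, hsupp, fun y => (hrange ⟨y, rfl⟩).1, x, by simp [hux]⟩

/-- for `m > 0` and disjoint nonempty open `G₁, G₂ ⊆ ℝ³`, there are smooth
compactly supported real-valued `u, v` supported in `G₁`, `G₂` respectively with
`⟪u, H⁻¹ v⟫ ≠ 0`. -/
theorem exists_nonorthogonal_Hinv (m : ℝ) (hm : 0 < m)
    (G₁ G₂ : Set E3) (hG₁ : IsOpen G₁) (hG₂ : IsOpen G₂) (hdisj : Disjoint G₁ G₂)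
    (hG₁ne : G₁.Nonempty) (hG₂ne : G₂.Nonempty) :
    ∃ u v : E3 → ℝ,
      ContDiff ℝ (⊤ : ℕ∞) u ∧ HasCompactSupport u ∧ tsupport u ⊆ G₁ ∧
      ContDiff ℝ (⊤ : ℕ∞) v ∧ HasCompactSupport v ∧ tsupport v ⊆ G₂ ∧
      ∫ x : E3, (starRingEnd ℂ) (u x) * Hpow m (-1) (fun y => (v y : ℂ)) x ≠ 0 := by
  obtain ⟨u, hu, huc, hus, hu0, x₀, hx₀⟩ := exists_contDiff_nonneg_tsupport_subset hG₁ hG₁ne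
  obtain ⟨v, hv, hvc, hvs, hv0, y₀, hy₀⟩ := exists_contDiff_nonneg_tsupport_subset hG₂ hG₂ne
  refine ⟨u, v, hu, huc, hus, hv, hvc, hvs, ?_⟩
  choose r hr hHr using exists_pos_Hpow_neg_one_eq hm hv hvc hv0 hy₀
  have hrc : Continuous r := by
    have h := continuous_re.comp
      (continuous_Hpow_neg_one hm (integrable_fourier_of_contDiff hv hvc))
    simpa only [Function.comp_def, hHr, ofReal_re] using h
  have hpos : 0 < ∫ x, u x * r x :=
    (hu.continuous.mul hrc).integral_pos_of_hasCompactSupport_nonneg_nonzero huc.mul_right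
      (fun x => mul_nonneg (hu0 x) (hr x).le) (mul_ne_zero hx₀ (hr x₀).ne')
  simp only [hHr, conj_ofReal, ← ofReal_mul]
  rw [integral_complex_ofReal]
  exact ofReal_ne_zero.2 hpos.ne'

end
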